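/- Let P be a collection of m points in ℂ² and L a collection of n complex lines in ℂ². Then the number of incidences between points of P and lines of L is O(m^{2/3}n^{2/3} + m + n). -/

import Mathlib

namespace ComplexSzemerediTrotter

open Finset
open scoped Classical

/-- The point `p` lies on the non-vertical line `y = l.1 * x + l.2`. -/
def OnLine (p l : ℂ × ℂ) : Prop := p.2 = l.1 * p.1 + l.2

/-- The lines of `L` through the point `p`. -/
noncomputable def linesAt (L : Finset (ℂ × ℂ)) (p : ℂ × ℂ) : Finset (ℂ × ℂ) :=
  L.filter (OnLine p)

/-- The lines of `L` through at least one point of `S`. -/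
noncomputable def linesMeeting (L S : Finset (ℂ × ℂ)) : Finset (ℂ × ℂ) :=
  L.filter fun l => ∃ p ∈ S, OnLine p l

lemma OnLine.eq_of_ne {p q l l' : ℂ × ℂ} (hpq : p ≠ q) (hpl : OnLine p l) (hql : OnLine q l)
    (hpl' : OnLine p l') (hql' : OnLine q l') : l = l' := by
  unfold OnLine at *
  have hx : p.1 - q.1 ≠ 0 := by
    intro h
    have h1 : p.1 = q.1 := sub_eq_zero.mp h
    exact hpq (Prod.ext h1 (by rw [hpl, hql, h1]))
  have h1 : l.1 = l'.1 := by
    have : (l.1 - l'.1) * (p.1 - q.1) = 0 := by linear_combination hpl' - hpl - hql' + hql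
    rcases mul_eq_zero.mp this with h | h
    · exact sub_eq_zero.mp h
    · exact absurd h hx
  refine Prod.ext h1 ?_
  rw [h1] at hpl
  linear_combination hpl' - hpl

lemma card_linesAt_inter_le (L : Finset (ℂ × ℂ)) {p q : ℂ × ℂ} (hpq : p ≠ q) :
    #(linesAt L p ∩ linesAt L q) ≤ 1 := by
  rw [Finset.card_le_one]
  intro a ha b hb
  simp only [linesAt, mem_inter, mem_filter] at ha hb
  exact OnLine.eq_of_ne hpq ha.1.2 ha.2.2 hb.1.2 hb.2.2

lemma sum_card_linesAt_le (L S : Finset (ℂ × ℂ)) :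
    ∑ p ∈ S, #(linesAt L p) ≤ #(linesMeeting L S) + #S ^ 2 := by
  induction S using Finset.induction_on with
  | empty => simp
  | insert p S hp ih =>
    rw [sum_insert hp, card_insert_of_notMem hp]
    have hunion : linesMeeting L (insert p S) = linesAt L p ∪ linesMeeting L S := by
      ext l
      simp only [linesMeeting, linesAt, mem_filter, mem_union, mem_insert, exists_eq_or_imp]
      tauto
    have hinter : #(linesAt L p ∩ linesMeeting L S) ≤ #S := by
      have hsub : linesAt L p ∩ linesMeeting L S ⊆ S.biUnion fun q => linesAt L p ∩ linesAt L q := by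
        intro l hl
        simp only [linesMeeting, linesAt, mem_inter, mem_filter, mem_biUnion] at hl ⊢
        obtain ⟨⟨h1, h2⟩, _, q, hq, hql⟩ := hl
        exact ⟨q, hq, ⟨h1, h2⟩, h1, hql⟩
      refine (card_le_card hsub).trans (card_biUnion_le.trans ?_)
      calc ∑ q ∈ S, #(linesAt L p ∩ linesAt L q) ≤ ∑ _q ∈ S, 1 :=
            sum_le_sum fun q hq => card_linesAt_inter_le L (by rintro rfl; exact hp hq)
        _ = #S := by simp
    have := card_union_add_card_inter (linesAt L p) (linesMeeting L S)
    rw [hunion]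
    nlinarith

lemma linesMeeting_subset (L S : Finset (ℂ × ℂ)) : linesMeeting L S ⊆ L := filter_subset _ _

/-- A smallest ball, among those centred at a point of a finite family, that contains at least
`t` members of the family. -/
lemma exists_min_ball {α E : Type*} [MetricSpace E] (S : Finset α) (f : α → E) {t : ℕ}
    (ht : 1 ≤ t) (htS : t ≤ #S) :
    ∃ c ∈ S, ∃ ρ : ℝ, 0 ≤ ρ ∧ t ≤ #(S.filter fun z => dist (f z) (f c) ≤ ρ) ∧
      ∀ p ∈ S, #(S.filter fun z => dist (f z) (f p) < ρ) < t := by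
  set Q := (S ×ˢ S).filter fun x : α × α =>
    t ≤ #(S.filter fun z => dist (f z) (f x.1) ≤ dist (f x.2) (f x.1)) with hQ
  have key : ∀ p ∈ S, ∀ R ⊆ S, t ≤ #R → ∃ q ∈ R, (p, q) ∈ Q := by
    intro p hp R hR hRt
    have hne : R.Nonempty := card_pos.mp (by omega)
    obtain ⟨q, hq, hmax⟩ := exists_max_image R (fun z => dist (f z) (f p)) hne
    refine ⟨q, hq, ?_⟩
    simp only [hQ, mem_filter, mem_product]
    refine ⟨⟨hp, hR hq⟩, hRt.trans (card_le_card ?_)⟩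
    intro z hz
    exact mem_filter.mpr ⟨hR hz, hmax z hz⟩
  have hSne : S.Nonempty := card_pos.mp (by omega)
  obtain ⟨p₀, hp₀⟩ := hSne
  obtain ⟨q₀, _, hQ₀⟩ := key p₀ hp₀ S subset_rfl htS
  obtain ⟨⟨c, q⟩, hcq, hmin⟩ := exists_min_image Q (fun x => dist (f x.2) (f x.1)) ⟨_, hQ₀⟩
  have hcq' := hcq
  simp only [hQ, mem_filter, mem_product] at hcq'
  refine ⟨c, hcq'.1.1, dist (f q) (f c), dist_nonneg, hcq'.2, ?_⟩
  intro p hp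
  by_contra! hcon
  obtain ⟨q', hq', hpq'⟩ := key p hp _ (filter_subset _ _) hcon
  have h1 := hmin _ hpq'
  have h2 := (mem_filter.mp hq').2
  simp only at h1
  linarith

/-- If every ball of radius `ρ` contains at most `q` members of a finite family, then a ball of
radius `A * ρ` contains at most `N * q` of them, where `N` depends on `A` and the space only. -/
lemma exists_card_ball_le (E : Type*) [NormedAddCommGroup E] [NormedSpace ℝ E] [ProperSpace E]
    (A : ℝ) :
    ∃ N : ℕ, 1 ≤ N ∧ ∀ {α : Type} (S : Finset α) (f : α → E) (ρ : ℝ) (q : ℝ) (c : E), 0 < ρ →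
      0 ≤ q →
      (∀ p ∈ S, (#(S.filter fun z => dist (f z) (f p) < ρ) : ℝ) ≤ q) →
      (#(S.filter fun z => dist (f z) c ≤ A * ρ) : ℝ) ≤ N * q := by
  obtain ⟨t, -, htfin, ht⟩ := (isCompact_closedBall (0 : E) A).finite_cover_balls
    (show (0 : ℝ) < 1 / 2 by norm_num)
  refine ⟨#htfin.toFinset + 1, by omega, ?_⟩
  intro α S f ρ q c hρ hq hS
  have hsub : (S.filter fun z => dist (f z) c ≤ A * ρ) ⊆
      htfin.toFinset.biUnion fun x => S.filter fun z => dist (ρ⁻¹ • (f z - c)) x < 1 / 2 := by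
    intro z hz
    obtain ⟨hzS, hz⟩ := mem_filter.mp hz
    have hmem : ρ⁻¹ • (f z - c) ∈ Metric.closedBall (0 : E) A := by
      rw [mem_closedBall_zero_iff, norm_smul, ← dist_eq_norm, norm_inv, Real.norm_of_nonneg hρ.le,
        inv_mul_le_iff₀ hρ]
      linarith
    obtain ⟨x, hx, hzx⟩ := Set.mem_iUnion₂.mp (ht hmem)
    exact mem_biUnion.mpr ⟨x, htfin.mem_toFinset.mpr hx, mem_filter.mpr ⟨hzS, hzx⟩⟩
  have hpiece : ∀ x ∈ htfin.toFinset,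
      (#(S.filter fun z => dist (ρ⁻¹ • (f z - c)) x < 1 / 2) : ℝ) ≤ q := by
    intro x _
    rcases (S.filter fun z => dist (ρ⁻¹ • (f z - c)) x < 1 / 2).eq_empty_or_nonempty with h | ⟨p, hp⟩
    · rw [h]
      simpa using hq
    · obtain ⟨hpS, hp⟩ := mem_filter.mp hp
      refine le_trans (Nat.cast_le.mpr (card_le_card ?_)) (hS p hpS)
      intro z hz
      obtain ⟨hzS, hz⟩ := mem_filter.mp hz
      refine mem_filter.mpr ⟨hzS, ?_⟩
      have h1 : dist (ρ⁻¹ • (f z - c)) (ρ⁻¹ • (f p - c)) < 1 := by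
        linarith [dist_triangle_right (ρ⁻¹ • (f z - c)) (ρ⁻¹ • (f p - c)) x]
      rw [dist_smul₀, dist_sub_right, norm_inv, Real.norm_of_nonneg hρ.le,
        inv_mul_lt_iff₀ hρ, mul_one] at h1
      exact h1
  calc (#(S.filter fun z => dist (f z) c ≤ A * ρ) : ℝ)
      ≤ ((∑ x ∈ htfin.toFinset, #(S.filter fun z => dist (ρ⁻¹ • (f z - c)) x < 1 / 2) : ℕ) : ℝ) :=
        Nat.cast_le.mpr ((card_le_card hsub).trans card_biUnion_le)
    _ ≤ ∑ _x ∈ htfin.toFinset, q := by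
        rw [Nat.cast_sum]
        exact sum_le_sum hpiece
    _ ≤ ((#htfin.toFinset + 1 : ℕ) : ℝ) * q := by
        rw [sum_const, nsmul_eq_mul]
        push_cast
        nlinarith

/-- The intersection point of two lines with distinct slopes. -/
noncomputable def crossing (h v : ℂ × ℂ) : ℂ × ℂ :=
  ((h.2 - v.2) / (v.1 - h.1), h.1 * ((h.2 - v.2) / (v.1 - h.1)) + h.2)

lemma onLine_crossing_left (h v : ℂ × ℂ) : OnLine (crossing h v) h := rfl

lemma onLine_crossing_right {h v : ℂ × ℂ} (hne : h.1 ≠ v.1) : OnLine (crossing h v) v := by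
  have : v.1 - h.1 ≠ 0 := sub_ne_zero.mpr (Ne.symm hne)
  simp only [OnLine, crossing]
  field_simp
  ring

lemma norm_sub_of_onLine {p q l : ℂ × ℂ} (hp : OnLine p l) (hq : OnLine q l) :
    ‖p.2 - q.2‖ = ‖l.1‖ * ‖p.1 - q.1‖ := by
  rw [← norm_mul, hp, hq]
  congr 1
  ring

lemma norm_sub_le_of_flat {p q l : ℂ × ℂ} (hl : ‖l.1‖ ≤ 1 / 4) (hp : OnLine p l)
    (hq : OnLine q l) : ‖p.2 - q.2‖ ≤ 1 / 4 * ‖p.1 - q.1‖ := by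
  rw [norm_sub_of_onLine hp hq]
  exact mul_le_mul_of_nonneg_right hl (norm_nonneg _)

lemma norm_sub_le_of_steep {p q l : ℂ × ℂ} (hl : 4 ≤ ‖l.1‖) (hp : OnLine p l)
    (hq : OnLine q l) : ‖p.1 - q.1‖ ≤ 1 / 4 * ‖p.2 - q.2‖ := by
  rw [norm_sub_of_onLine hp hq]
  nlinarith [norm_nonneg (p.1 - q.1)]

lemma dist_prod_le_iff {p q : ℂ × ℂ} {r : ℝ} :
    dist p q ≤ r ↔ ‖p.1 - q.1‖ ≤ r ∧ ‖p.2 - q.2‖ ≤ r := by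
  rw [Prod.dist_eq, max_le_iff, dist_eq_norm, dist_eq_norm]

lemma lt_dist_prod_iff {p q : ℂ × ℂ} {r : ℝ} :
    r < dist p q ↔ r < ‖p.1 - q.1‖ ∨ r < ‖p.2 - q.2‖ := by
  rw [Prod.dist_eq, lt_max_iff, dist_eq_norm, dist_eq_norm]

lemma dist_crossing_le {h v u w o c : ℂ × ℂ} {ρ : ℝ} (hh : ‖h.1‖ ≤ 1 / 4) (hv : 4 ≤ ‖v.1‖)
    (hu : OnLine u h) (hw : OnLine w v) (hoh : OnLine o h) (hov : OnLine o v)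
    (huc : dist u c ≤ ρ) (hwc : dist w c ≤ ρ) : dist o c ≤ 2 * ρ := by
  rw [dist_prod_le_iff] at huc hwc ⊢
  obtain ⟨hu1, hu2⟩ := huc
  obtain ⟨hw1, hw2⟩ := hwc
  have h1 := norm_sub_le_of_flat hh hoh hu
  have h2 := norm_sub_le_of_steep hv hov hw
  have t1 := norm_sub_le_norm_sub_add_norm_sub o.2 u.2 w.2
  have t2 := norm_sub_le_norm_sub_add_norm_sub u.2 c.2 w.2
  have t3 := norm_sub_le_norm_sub_add_norm_sub o.1 w.1 u.1
  have t4 := norm_sub_le_norm_sub_add_norm_sub w.1 c.1 u.1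
  have t5 := norm_sub_le_norm_sub_add_norm_sub o.1 w.1 c.1
  have t6 := norm_sub_le_norm_sub_add_norm_sub o.2 u.2 c.2
  rw [norm_sub_rev c.2 w.2] at t2
  rw [norm_sub_rev c.1 u.1] at t4
  have hρ := norm_nonneg (u.1 - c.1)
  constructor <;> linarith

lemma fst_lt_snd_of_steep {v w o c : ℂ × ℂ} {ρ : ℝ} (hρ : 0 < ρ) (hv : 4 ≤ ‖v.1‖)
    (hw : OnLine w v) (hov : OnLine o v) (hoc : dist o c ≤ 3 * ρ) (hwc : 20 * ρ < dist w c) :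
    ‖w.1 - c.1‖ < ‖w.2 - c.2‖ := by
  rw [dist_prod_le_iff] at hoc
  rw [lt_dist_prod_iff] at hwc
  have h2 := norm_sub_le_of_steep hv hw hov
  have t1 := norm_sub_le_norm_sub_add_norm_sub w.1 o.1 c.1
  have t2 := norm_sub_le_norm_sub_add_norm_sub w.2 o.2 c.2
  have t3 := norm_sub_le_norm_sub_add_norm_sub w.2 c.2 o.2
  rw [norm_sub_rev c.2 o.2] at t3
  rcases hwc with h | h <;> linarith

lemma snd_lt_fst_of_flat {h u o c : ℂ × ℂ} {ρ : ℝ} (hρ : 0 < ρ) (hh : ‖h.1‖ ≤ 1 / 4)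
    (hu : OnLine u h) (hoh : OnLine o h) (hoc : dist o c ≤ 3 * ρ) (huc : 20 * ρ < dist u c) :
    ‖u.2 - c.2‖ < ‖u.1 - c.1‖ := by
  rw [dist_prod_le_iff] at hoc
  rw [lt_dist_prod_iff] at huc
  have h2 := norm_sub_le_of_flat hh hu hoh
  have t1 := norm_sub_le_norm_sub_add_norm_sub u.1 o.1 c.1
  have t2 := norm_sub_le_norm_sub_add_norm_sub u.2 o.2 c.2
  have t3 := norm_sub_le_norm_sub_add_norm_sub u.1 c.1 o.1
  rw [norm_sub_rev c.1 o.1] at t3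
  rcases huc with h | h <;> linarith

/-- The pairs of a line of `H` and a line of `V` that do not cross in `ball (c, 3ρ)`, for any of
the pairs `(c, ρ)` in `K`. -/
noncomputable def freePairs (H V : Finset (ℂ × ℂ)) (K : Finset ((ℂ × ℂ) × ℝ)) :
    Finset ((ℂ × ℂ) × (ℂ × ℂ)) :=
  (H ×ˢ V).filter fun x => ∀ κ ∈ K, 3 * κ.2 < dist (crossing x.1 x.2) κ.1

lemma card_mul_le_linesMeeting {L S : Finset (ℂ × ℂ)} {k : ℕ} (hS : 2 * #S ≤ k)
    (hk : ∀ p ∈ S, k ≤ #(linesAt L p)) : #S * k ≤ 2 * #(linesMeeting L S) := by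
  have h1 := sum_card_linesAt_le L S
  have h2 : #S * k ≤ ∑ p ∈ S, #(linesAt L p) := by
    rw [← smul_eq_mul]
    exact card_nsmul_le_sum _ _ _ hk
  nlinarith

lemma exists_subset_same_type {P : Finset (ℂ × ℂ)} (x : ℂ × ℂ) {s : ℕ} (hs : 2 * s ≤ #P) :
    ∃ S ⊆ P, #S = s ∧ ((∀ z ∈ S, ‖z.1 - x.1‖ ≤ ‖z.2 - x.2‖) ∨
      ∀ z ∈ S, ‖z.2 - x.2‖ ≤ ‖z.1 - x.1‖) := by
  have h := card_filter_add_card_filter_not (s := P) (fun z : ℂ × ℂ => ‖z.1 - x.1‖ ≤ ‖z.2 - x.2‖)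
  rcases le_total s #(P.filter fun z => ‖z.1 - x.1‖ ≤ ‖z.2 - x.2‖) with h1 | h1
  · obtain ⟨S, hS, hc⟩ := exists_subset_card_eq h1
    exact ⟨S, hS.trans (filter_subset _ _), hc, Or.inl fun z hz => (mem_filter.mp (hS hz)).2⟩
  · have h2 : s ≤ #(P.filter fun z => ¬ ‖z.1 - x.1‖ ≤ ‖z.2 - x.2‖) := by omega
    obtain ⟨S, hS, hc⟩ := exists_subset_card_eq h2
    exact ⟨S, hS.trans (filter_subset _ _), hc,
      Or.inr fun z hz => (not_le.mp (mem_filter.mp (hS hz)).2).le⟩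

/-- Passing from the cores `K` to the cores `insert (c, ρ) (K \ near)` uses up all pairs of lines
that meet `S`, provided at most one core is near to the ball around `c`. -/
lemma card_freePairs_add_le {H V S : Finset (ℂ × ℂ)} {K : Finset ((ℂ × ℂ) × ℝ)} {c x : ℂ × ℂ}
    {ρ : ℝ} (hρ : 0 < ρ) (hH : ∀ h ∈ H, ‖h.1‖ ≤ 1 / 4) (hV : ∀ v ∈ V, 4 ≤ ‖v.1‖)
    (hSc : ∀ z ∈ S, dist z c ≤ ρ) (hKpos : ∀ κ ∈ K, 0 < κ.2)
    (hKc : ∀ κ ∈ K, 20 * κ.2 < dist c κ.1)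
    (hKS : ∀ κ ∈ K, ∀ z ∈ S, 20 * κ.2 < dist z κ.1)
    (hnear : ∀ κ ∈ K, dist κ.1 c ≤ 3 * κ.2 + 2 * ρ → κ.1 = x)
    (htype : (∀ z ∈ S, ‖z.1 - x.1‖ ≤ ‖z.2 - x.2‖) ∨ ∀ z ∈ S, ‖z.2 - x.2‖ ≤ ‖z.1 - x.1‖) :
    #(freePairs H V (insert (c, ρ) (K.filter fun κ => ¬ dist κ.1 c ≤ 3 * κ.2 + 2 * ρ))) +
      #(linesMeeting H S) * #(linesMeeting V S) ≤ #(freePairs H V K) := by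
  rw [← card_product, ← card_union_of_disjoint]
  · refine card_le_card (union_subset ?_ ?_)
    · intro y hy
      simp only [freePairs, mem_filter, mem_insert, forall_eq_or_imp, and_imp] at hy ⊢
      refine ⟨hy.1, fun κ hκ => ?_⟩
      by_cases hn : dist κ.1 c ≤ 3 * κ.2 + 2 * ρ
      · have h1 := hKc κ hκ
        have h2 := hy.2.1
        have h3 := dist_triangle (crossing y.1 y.2) κ.1 c
        rw [dist_comm] at h1
        linarith
      · exact hy.2.2 κ hκ hn
    · rintro ⟨h, v⟩ hy
      simp only [linesMeeting, mem_product, mem_filter] at hy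
      obtain ⟨⟨hh, u, huS, hu⟩, hv, w, hwS, hw⟩ := hy
      have hne : h.1 ≠ v.1 := by
        intro e
        have h1 := hH h hh
        have h2 := hV v hv
        rw [e] at h1
        linarith
      have hoh := onLine_crossing_left h v
      have hov := onLine_crossing_right hne
      have hoc := dist_crossing_le (hH h hh) (hV v hv) hu hw hoh hov (hSc u huS) (hSc w hwS)
      simp only [freePairs, mem_filter, mem_product]
      refine ⟨⟨hh, hv⟩, fun κ hκ => ?_⟩
      by_contra! hcon
      by_cases hn : dist κ.1 c ≤ 3 * κ.2 + 2 * ρ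
      · have e := hnear κ hκ hn
        have h1 := snd_lt_fst_of_flat (hKpos κ hκ) (hH h hh) hu hoh hcon (hKS κ hκ u huS)
        have h2 := fst_lt_snd_of_steep (hKpos κ hκ) (hV v hv) hw hov hcon (hKS κ hκ w hwS)
        rw [e] at h1 h2
        rcases htype with ht | ht
        · linarith [ht u huS]
        · linarith [ht w hwS]
      · have h3 := dist_triangle_left κ.1 c (crossing h v)
        linarith
  · rw [disjoint_left]
    rintro ⟨h, v⟩ hy hy'
    simp only [freePairs, mem_filter, mem_insert, forall_eq_or_imp] at hy
    simp only [linesMeeting, mem_product, mem_filter] at hy'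
    obtain ⟨⟨hh, u, huS, hu⟩, hv, w, hwS, hw⟩ := hy'
    have hne : h.1 ≠ v.1 := by
      intro e
      have h1 := hH h hh
      have h2 := hV v hv
      rw [e] at h1
      linarith
    have hoc := dist_crossing_le (hH h hh) (hV v hv) hu hw (onLine_crossing_left h v)
      (onLine_crossing_right hne) (hSc u huS) (hSc w hwS)
    linarith [hy.2.1]

lemma freePairs_subset {H V : Finset (ℂ × ℂ)} {K : Finset ((ℂ × ℂ) × ℝ)} {c : ℂ × ℂ}
    {ρ : ℝ} (hKc : ∀ κ ∈ K, 20 * κ.2 < dist c κ.1) :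
    freePairs H V (insert (c, ρ) (K.filter fun κ => ¬ dist κ.1 c ≤ 3 * κ.2 + 2 * ρ)) ⊆
      freePairs H V K := by
  intro y hy
  simp only [freePairs, mem_filter, mem_insert, forall_eq_or_imp, and_imp] at hy ⊢
  refine ⟨hy.1, fun κ hκ => ?_⟩
  by_cases hn : dist κ.1 c ≤ 3 * κ.2 + 2 * ρ
  · have h1 := hKc κ hκ
    have h2 := hy.2.1
    have h3 := dist_triangle (crossing y.1 y.2) κ.1 c
    rw [dist_comm] at h1
    linarith [dist_nonneg (x := κ.1) (y := c)]
  · exact hy.2.2 κ hκ hn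

/-- The induction removes points from `P` ball by ball, keeping a record `K` of the balls around
which crossings have already been counted. -/
lemma card_mul_le_freePairs {N : ℕ} (hN : 1 ≤ N)
    (hcover : ∀ (S : Finset (ℂ × ℂ)) (ρ q : ℝ) (c : ℂ × ℂ), 0 < ρ → 0 ≤ q →
      (∀ p ∈ S, (#(S.filter fun z => dist z p < ρ) : ℝ) ≤ q) →
      (#(S.filter fun z => dist z c ≤ 20 * ρ) : ℝ) ≤ N * q)
    {H V : Finset (ℂ × ℂ)} (hH : ∀ h ∈ H, ‖h.1‖ ≤ 1 / 4) (hV : ∀ v ∈ V, 4 ≤ ‖v.1‖)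
    {s k : ℕ} (hs : 1 ≤ s) (hsk : 2 * s ≤ k) (P : Finset (ℂ × ℂ))
    (hPH : ∀ p ∈ P, k ≤ #(linesAt H p)) (hPV : ∀ p ∈ P, k ≤ #(linesAt V p))
    (K : Finset ((ℂ × ℂ) × ℝ)) (hKpos : ∀ κ ∈ K, 0 < κ.2)
    (hKP : ∀ κ ∈ K, ∀ p ∈ P, 20 * κ.2 < dist p κ.1) :
    #P * (s * k ^ 2) ≤ 16 * N * #(freePairs H V K) + 2 * N * (s * (s * k ^ 2)) * (#K + 1) := by
  induction P using Finset.strongInduction generalizing K with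
  | H P ih =>
  by_cases hsmall : #P < 2 * s
  · calc #P * (s * k ^ 2) ≤ (2 * s) * (s * k ^ 2) := Nat.mul_le_mul_right _ hsmall.le
      _ ≤ 2 * N * (s * (s * k ^ 2)) * (#K + 1) := by
        have : 1 ≤ N * (#K + 1) := Nat.one_le_iff_ne_zero.mpr (by positivity)
        nlinarith [Nat.zero_le (s * (s * k ^ 2))]
      _ ≤ _ := Nat.le_add_left _ _
  push Not at hsmall
  obtain ⟨c, hcP, ρ, hρ0, hball, hmin⟩ := exists_min_ball P id (by omega) hsmall
  simp only [id] at hball hmin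
  have hρ : 0 < ρ := by
    rcases hρ0.lt_or_eq with h | h
    · exact h
    · exfalso
      have h1 : (P.filter fun z => dist z c ≤ ρ) ⊆ {c} := by
        intro z hz
        have := (mem_filter.mp hz).2
        rw [← h] at this
        exact mem_singleton.mpr (dist_le_zero.mp this)
      have := card_le_card h1
      rw [card_singleton] at this
      omega
  have hKc : ∀ κ ∈ K, 20 * κ.2 < dist c κ.1 := fun κ hκ => hKP κ hκ c hcP
  set K' := insert (c, ρ) (K.filter fun κ => ¬ dist κ.1 c ≤ 3 * κ.2 + 2 * ρ) with hK'
  set P' := P.filter fun z => ¬ dist z c ≤ 20 * ρ with hP'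
  have hremoved : #(P.filter fun z => dist z c ≤ 20 * ρ) ≤ N * (2 * s) := by
    have := hcover P ρ ((2 * s : ℕ) : ℝ) c hρ (by positivity)
      fun p hp => Nat.cast_le.mpr (hmin p hp).le
    exact_mod_cast this
  have hPcard : #P ≤ #P' + N * (2 * s) := by
    have := card_filter_add_card_filter_not (s := P) (fun z => dist z c ≤ 20 * ρ)
    rw [← hP'] at this
    omega
  have hPss : P' ⊂ P := by
    refine filter_ssubset.mpr ⟨c, hcP, ?_⟩
    rw [dist_self, not_not]
    positivity
  have hrec := ih P' hPss (fun p hp => hPH p (hPss.1 hp)) (fun p hp => hPV p (hPss.1 hp)) K'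
    (by
      intro κ hκ
      rcases mem_insert.mp hκ with rfl | hκ
      · exact hρ
      · exact hKpos κ (mem_filter.mp hκ).1)
    (by
      intro κ hκ p hp
      rcases mem_insert.mp hκ with rfl | hκ
      · exact not_le.mp (mem_filter.mp hp).2
      · exact hKP κ (mem_filter.mp hκ).1 p (hPss.1 hp))
  have hmul : #P * (s * k ^ 2) ≤ #P' * (s * k ^ 2) + 2 * N * (s * (s * k ^ 2)) := by
    calc #P * (s * k ^ 2) ≤ (#P' + N * (2 * s)) * (s * k ^ 2) := Nat.mul_le_mul_right _ hPcard
      _ = _ := by ring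
  have hcardK' : #K' ≤ #(K.filter fun κ => ¬ dist κ.1 c ≤ 3 * κ.2 + 2 * ρ) + 1 :=
    card_insert_le _ _
  have hKsplit := card_filter_add_card_filter_not (s := K)
    (fun κ => dist κ.1 c ≤ 3 * κ.2 + 2 * ρ)
  by_cases hnear : #(K.filter fun κ => dist κ.1 c ≤ 3 * κ.2 + 2 * ρ) ≤ 1
  · obtain ⟨x, hx⟩ := card_le_one_iff_subset_singleton.mp hnear
    obtain ⟨S, hSsub, hScard, htype⟩ := exists_subset_same_type x.1 hball
    have hSP : S ⊆ P := hSsub.trans (filter_subset _ _)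
    have hfree := card_freePairs_add_le hρ hH hV (fun z hz => (mem_filter.mp (hSsub hz)).2) hKpos
      hKc (fun κ hκ z hz => hKP κ hκ z (hSP hz))
      (fun κ hκ hn => congrArg Prod.fst (mem_singleton.mp (hx (mem_filter.mpr ⟨hκ, hn⟩)))) htype
    have hmH := card_mul_le_linesMeeting (by omega) fun p hp => hPH p (hSP hp)
    have hmV := card_mul_le_linesMeeting (by omega) fun p hp => hPV p (hSP hp)
    rw [hScard] at hmH hmV
    have hpairs : s * (s * k ^ 2) ≤ 4 * (#(linesMeeting H S) * #(linesMeeting V S)) := by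
      calc s * (s * k ^ 2) = (s * k) * (s * k) := by ring
        _ ≤ (2 * #(linesMeeting H S)) * (2 * #(linesMeeting V S)) := Nat.mul_le_mul hmH hmV
        _ = _ := by ring
    have hK1 : #K' + 1 ≤ #K + 2 := by omega
    rw [← hK'] at hfree
    have e1 := Nat.mul_le_mul_left (2 * N * (s * (s * k ^ 2))) hK1
    have e2 := Nat.mul_le_mul_left (16 * N) hfree
    have e3 := Nat.mul_le_mul_left (4 * N) hpairs
    nlinarith
  · have hK1 : #K' + 1 ≤ #K := by omega
    have e1 := Nat.mul_le_mul_left (2 * N * (s * (s * k ^ 2))) hK1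
    have e2 := Nat.mul_le_mul_left (16 * N) (card_le_card (freePairs_subset (H := H) (V := V)
      (ρ := ρ) hKc))
    rw [← hK'] at e2
    nlinarith

/-- A point set that is `k`-rich both for flat lines and for steep lines is small. -/
lemma exists_card_mul_le_flat_steep :
    ∃ N : ℕ, ∀ (H V P : Finset (ℂ × ℂ)) (s k : ℕ), (∀ h ∈ H, ‖h.1‖ ≤ 1 / 4) →
      (∀ v ∈ V, 4 ≤ ‖v.1‖) → 1 ≤ s → 2 * s ≤ k → (∀ p ∈ P, k ≤ #(linesAt H p)) →
      (∀ p ∈ P, k ≤ #(linesAt V p)) →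
      #P * (s * k ^ 2) ≤ N * (#H * #V + s * (s * k ^ 2)) := by
  obtain ⟨N, hN, hcover⟩ := exists_card_ball_le (ℂ × ℂ) 20
  refine ⟨16 * N, fun H V P s k hH hV hs hsk hPH hPV => ?_⟩
  have h := card_mul_le_freePairs hN (fun S => hcover S id) hH hV hs hsk P hPH hPV ∅
    (by simp) (by simp)
  have h2 : #(freePairs H V ∅) ≤ #H * #V := by
    rw [← card_product]
    exact card_filter_le _ _
  have h3 := Nat.mul_le_mul_left (16 * N) h2
  simp only [card_empty] at h
  nlinarith [Nat.zero_le (N * (s * (s * k ^ 2)))]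

/-- The affine change of coordinates `(x, y) ↦ (x, (y - c x) / σ)`. -/
noncomputable def shearPoint (c σ : ℂ) (p : ℂ × ℂ) : ℂ × ℂ := (p.1, (p.2 - c * p.1) / σ)

/-- The action of `shearPoint c σ` on non-vertical lines. -/
noncomputable def shearLine (c σ : ℂ) (l : ℂ × ℂ) : ℂ × ℂ := ((l.1 - c) / σ, l.2 / σ)

lemma shearPoint_injective {c σ : ℂ} (hσ : σ ≠ 0) : Function.Injective (shearPoint c σ) := by
  intro p q h
  simp only [shearPoint, Prod.mk.injEq] at h
  obtain ⟨h1, h2⟩ := h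
  rw [div_left_inj' hσ, h1] at h2
  exact Prod.ext h1 (by linear_combination h2)

lemma shearLine_injective {c σ : ℂ} (hσ : σ ≠ 0) : Function.Injective (shearLine c σ) := by
  intro p q h
  simp only [shearLine, Prod.mk.injEq] at h
  obtain ⟨h1, h2⟩ := h
  rw [div_left_inj' hσ] at h1 h2
  exact Prod.ext (by linear_combination h1) h2

lemma OnLine.shear {c σ : ℂ} {p l : ℂ × ℂ} (h : OnLine p l) :
    OnLine (shearPoint c σ p) (shearLine c σ l) := by
  simp only [OnLine, shearPoint, shearLine] at *
  rw [h]
  ring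

lemma card_linesAt_le_shear {c σ : ℂ} (hσ : σ ≠ 0) (L : Finset (ℂ × ℂ)) (p : ℂ × ℂ) :
    #(linesAt L p) ≤ #(linesAt (L.image (shearLine c σ)) (shearPoint c σ p)) := by
  rw [← card_image_of_injective (linesAt L p) (shearLine_injective (c := c) hσ)]
  refine card_le_card fun l hl => ?_
  obtain ⟨l', hl', rfl⟩ := mem_image.mp hl
  obtain ⟨h1, h2⟩ := mem_filter.mp hl'
  exact mem_filter.mpr ⟨mem_image_of_mem _ h1, h2.shear⟩

/-- A point set that is `k`-rich for two families of lines with well-separated slopes is small. -/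
lemma exists_card_mul_le_separated :
    ∃ N : ℕ, ∀ (H V P : Finset (ℂ × ℂ)) (s k : ℕ) (c : ℂ) (ρ : ℝ), 0 < ρ →
      (∀ h ∈ H, dist h.1 c ≤ ρ) → (∀ v ∈ V, 16 * ρ ≤ dist v.1 c) → 1 ≤ s → 2 * s ≤ k →
      (∀ p ∈ P, k ≤ #(linesAt H p)) → (∀ p ∈ P, k ≤ #(linesAt V p)) →
      #P * (s * k ^ 2) ≤ N * (#H * #V + s * (s * k ^ 2)) := by
  obtain ⟨N, hN⟩ := exists_card_mul_le_flat_steep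
  refine ⟨N, fun H V P s k c ρ hρ hH hV hs hsk hPH hPV => ?_⟩
  have hσ : ((4 * ρ : ℝ) : ℂ) ≠ 0 := Complex.ofReal_ne_zero.mpr (by positivity)
  have hnorm : ‖((4 * ρ : ℝ) : ℂ)‖ = 4 * ρ := by
    rw [Complex.norm_real, Real.norm_of_nonneg (by positivity)]
  have h := hN (H.image (shearLine c (4 * ρ : ℝ))) (V.image (shearLine c (4 * ρ : ℝ)))
    (P.image (shearPoint c (4 * ρ : ℝ))) s k ?_ ?_ hs hsk ?_ ?_
  · rwa [card_image_of_injective _ (shearPoint_injective hσ),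
      card_image_of_injective _ (shearLine_injective hσ),
      card_image_of_injective _ (shearLine_injective hσ)] at h
  · intro l hl
    obtain ⟨l', hl', rfl⟩ := mem_image.mp hl
    have := hH l' hl'
    rw [shearLine, norm_div, hnorm, ← dist_eq_norm, div_le_iff₀ (by positivity)]
    linarith
  · intro l hl
    obtain ⟨l', hl', rfl⟩ := mem_image.mp hl
    have := hV l' hl'
    rw [shearLine, norm_div, hnorm, ← dist_eq_norm, le_div_iff₀ (by positivity)]
    linarith
  · intro p hp
    obtain ⟨p', hp', rfl⟩ := mem_image.mp hp
    exact (hPH p' hp').trans (card_linesAt_le_shear hσ H p')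
  · intro p hp
    obtain ⟨p', hp', rfl⟩ := mem_image.mp hp
    exact (hPV p' hp').trans (card_linesAt_le_shear hσ V p')

/-- The real form of `exists_card_mul_le_separated`. -/
lemma exists_card_le_separated :
    ∃ C : ℝ, 0 < C ∧ ∀ (H V P : Finset (ℂ × ℂ)) (k : ℝ) (c : ℂ) (ρ : ℝ), 0 < ρ →
      (∀ h ∈ H, dist h.1 c ≤ ρ) → (∀ v ∈ V, 16 * ρ ≤ dist v.1 c) → 2 ≤ k →
      (∀ p ∈ P, k ≤ #(linesAt H p)) → (∀ p ∈ P, k ≤ #(linesAt V p)) →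
      (#P : ℝ) ≤ C * (#H * #V / k ^ 3 + k) := by
  obtain ⟨N, hN⟩ := exists_card_mul_le_separated
  refine ⟨32 * N + 1, by positivity, fun H V P k c ρ hρ hH hV hk hPH hPV => ?_⟩
  have hκ2 : 2 ≤ ⌊k⌋₊ := Nat.le_floor (by exact_mod_cast hk)
  have hκle : (⌊k⌋₊ : ℝ) ≤ k := Nat.floor_le (by linarith)
  have hκge : k / 2 ≤ (⌊k⌋₊ : ℝ) := by
    have h1 := Nat.lt_floor_add_one k
    have h2 : (2 : ℝ) ≤ (⌊k⌋₊ : ℝ) := by exact_mod_cast hκ2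
    linarith
  generalize hκ : ⌊k⌋₊ = κ at *
  have hsge : (κ : ℝ) / 4 ≤ ((κ / 2 : ℕ) : ℝ) := by
    have : κ ≤ 4 * (κ / 2) := by omega
    have : (κ : ℝ) ≤ 4 * ((κ / 2 : ℕ) : ℝ) := by exact_mod_cast this
    linarith
  have hsle : ((κ / 2 : ℕ) : ℝ) ≤ κ / 2 := Nat.cast_div_le
  have h := hN H V P (κ / 2) κ c ρ hρ hH hV (by omega) (by omega)
    (fun p hp => by exact_mod_cast hκle.trans (hPH p hp))
    (fun p hp => by exact_mod_cast hκle.trans (hPV p hp))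
  have hR : (#P : ℝ) * ((κ / 2 : ℕ) * (κ : ℝ) ^ 2) ≤
      N * (#H * #V + (κ / 2 : ℕ) * ((κ / 2 : ℕ) * (κ : ℝ) ^ 2)) := by exact_mod_cast h
  generalize ((κ / 2 : ℕ) : ℝ) = s at *
  have hκ0 : (0 : ℝ) < κ := by linarith
  have hs0 : 0 < s := by linarith
  have hD : k ^ 3 / 32 ≤ s * (κ : ℝ) ^ 2 := by
    calc k ^ 3 / 32 = (k / 2 / 4) * (k / 2) ^ 2 := by ring
      _ ≤ s * (κ : ℝ) ^ 2 := by
        gcongr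
        linarith
  have hD0 : 0 < s * (κ : ℝ) ^ 2 := by positivity
  have h1 : (#P : ℝ) ≤ N * (#H * #V / (s * (κ : ℝ) ^ 2) + s) := by
    rw [← mul_le_mul_iff_left₀ hD0]
    refine hR.trans (le_of_eq ?_)
    field_simp
  have h2 : (#H * #V : ℝ) / (s * (κ : ℝ) ^ 2) ≤ 32 * (#H * #V / k ^ 3) := by
    calc (#H * #V : ℝ) / (s * (κ : ℝ) ^ 2) ≤ (#H * #V) / (k ^ 3 / 32) := by gcongr
      _ = _ := by field_simp
  have h3 : s ≤ 32 * k := by linarith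
  calc (#P : ℝ) ≤ N * (#H * #V / (s * (κ : ℝ) ^ 2) + s) := h1
    _ ≤ N * (32 * (#H * #V / k ^ 3) + 32 * k) := by gcongr
    _ = 32 * N * (#H * #V / k ^ 3 + k) := by ring
    _ ≤ (32 * N + 1) * (#H * #V / k ^ 3 + k) := by
      have : (0 : ℝ) ≤ #H * #V / k ^ 3 + k := by positivity
      nlinarith

lemma card_le_sq_of_one_lt {L P : Finset (ℂ × ℂ)} (h : ∀ p ∈ P, 1 < #(linesAt L p)) :
    #P ≤ #L ^ 2 := by
  have hex : ∀ p ∈ P, ∃ x : (ℂ × ℂ) × (ℂ × ℂ),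
      x ∈ L ×ˢ L ∧ x.1 ≠ x.2 ∧ OnLine p x.1 ∧ OnLine p x.2 := by
    intro p hp
    obtain ⟨a, ha, b, hb, hab⟩ := one_lt_card.mp (h p hp)
    rw [linesAt, mem_filter] at ha hb
    exact ⟨(a, b), mem_product.mpr ⟨ha.1, hb.1⟩, hab, ha.2, hb.2⟩
  choose! f hf using hex
  rw [sq, ← card_product]
  refine card_le_card_of_injOn f (fun p hp => (hf p hp).1) fun p hp q hq hpq => ?_
  by_contra hne
  have h1 := hf p hp
  have h2 := hf q hq
  rw [← hpq] at h2
  exact h1.2.1 (OnLine.eq_of_ne hne h1.2.2.1 h2.2.2.1 h1.2.2.2 h2.2.2.2)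

lemma card_lt_of_sq_ge {L P : Finset (ℂ × ℂ)} {k : ℝ} (hk : 4 ≤ k) (hn : 16 * (#L : ℝ) ≤ k ^ 2)
    (h : ∀ p ∈ P, k ≤ #(linesAt L p)) : (#P : ℝ) < k / 4 := by
  rw [← Nat.lt_ceil]
  by_contra! hcon
  obtain ⟨S, hSP, hS⟩ := exists_subset_card_eq hcon
  have h1 : (#S : ℝ) * k ≤ ∑ p ∈ S, (#(linesAt L p) : ℝ) := by
    rw [← nsmul_eq_mul]
    exact card_nsmul_le_sum _ _ _ fun p hp => h p (hSP hp)
  have h2 : ∑ p ∈ S, (#(linesAt L p) : ℝ) ≤ #L + (#S : ℝ) ^ 2 := by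
    exact_mod_cast (sum_card_linesAt_le L S).trans
      (Nat.add_le_add_right (card_le_card (linesMeeting_subset L S)) _)
  have h3 : k / 4 ≤ (#S : ℝ) := by
    rw [hS]
    exact Nat.le_ceil _
  have h4 : (#S : ℝ) ≤ k / 2 := by
    rw [hS]
    linarith [Nat.ceil_lt_add_one (show 0 ≤ k / 4 by linarith)]
  nlinarith [mul_nonneg (sub_nonneg.mpr h3) (show (0 : ℝ) ≤ k - #S - k / 2 by linarith)]

lemma card_linesAt_split (L : Finset (ℂ × ℂ)) (p : ℂ × ℂ) (r : ℂ × ℂ → Prop) :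
    #(linesAt (L.filter r) p) + #(linesAt (L.filter fun l => ¬ r l) p) = #(linesAt L p) := by
  have := card_filter_add_card_filter_not (s := linesAt L p) r
  rw [← this]
  simp only [linesAt, filter_filter, and_comm]

lemma card_linesAt_le_one_of_parallel {L : Finset (ℂ × ℂ)} {c : ℂ} (hL : ∀ l ∈ L, l.1 = c)
    (p : ℂ × ℂ) : #(linesAt L p) ≤ 1 := by
  rw [card_le_one]
  intro a ha b hb
  simp only [linesAt, mem_filter, OnLine] at ha hb
  have h1 := hL a ha.1
  have h2 := hL b hb.1
  refine Prod.ext (h1.trans h2.symm) ?_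
  have h3 := ha.2
  have h4 := hb.2
  rw [h1] at h3
  rw [h2] at h4
  linear_combination h4 - h3

lemma contraction_arith {K X a b d θ A k C : ℝ} (hK : 0 ≤ K) (hX : 0 ≤ X) (hd : 0 < d)
    (hab : a + b ≤ 1 - θ) (hθ : (1 - θ) / d ≤ 1 - θ / 2)
    (hA : 512 + A + 256 * C ≤ K * (θ / 2)) (hk : k ≤ 256 * X) (hC : 0 ≤ C) :
    K * a / d * X + k + (K * b / d * X + k) + (A * X + C * k) ≤ K * X := by
  have h1 : (a + b) / d ≤ 1 - θ / 2 := (div_le_div_of_nonneg_right hab hd.le).trans hθ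
  have h2 : K * X * ((a + b) / d) ≤ K * X * (1 - θ / 2) :=
    mul_le_mul_of_nonneg_left h1 (mul_nonneg hK hX)
  have h3 : (512 + A + 256 * C) * X ≤ K * (θ / 2) * X := mul_le_mul_of_nonneg_right hA hX
  have h4 : C * k ≤ C * (256 * X) := mul_le_mul_of_nonneg_left hk hC
  have h5 : K * a / d * X + K * b / d * X = K * X * ((a + b) / d) := by ring
  linarith

set_option maxHeartbeats 1000000 in
/-- The number of points on at least `k` of `n` lines is `O(n² / k³ + k)`. -/
lemma exists_card_rich_le :
    ∃ K : ℝ, 0 < K ∧ ∀ (L P : Finset (ℂ × ℂ)) (k : ℝ), 1 < k → (∀ p ∈ P, k ≤ #(linesAt L p)) →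
      (#P : ℝ) ≤ K * ((#L : ℝ) ^ 2 / k ^ 3) + k := by
  obtain ⟨C, hC, hsep⟩ := exists_card_le_separated
  obtain ⟨N, hN, hcover⟩ := exists_card_ball_le ℂ 16
  have hN1 : (1 : ℝ) ≤ N := by exact_mod_cast hN
  obtain ⟨θ, hθ⟩ : ∃ θ : ℝ, θ = 1 / ((N : ℝ) ^ 2 + 1) := ⟨_, rfl⟩
  have hθ0 : 0 < θ := by rw [hθ]; positivity
  have hθN : θ * ((N : ℝ) ^ 2 + 1) = 1 := by rw [hθ]; field_simp
  have hθ1 : θ ≤ 1 / 2 := by nlinarith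
  have hNθ : N * θ < 1 := by nlinarith
  obtain ⟨δ, hδ⟩ : ∃ δ : ℝ, δ = θ / 12 := ⟨_, rfl⟩
  have hδ0 : 0 < δ := by linarith
  have hδ1 : δ ≤ 1 / 24 := by linarith
  have hδ3 : (1 - θ) / (1 - δ) ^ 3 ≤ 1 - θ / 2 := by
    rw [div_le_iff₀ (by apply pow_pos; linarith)]
    have h1 : 1 - 3 * δ ≤ (1 - δ) ^ 3 := by nlinarith [pow_pos hδ0 2]
    have h2 : (1 - θ / 2) * (1 - 3 * δ) ≤ (1 - θ / 2) * (1 - δ) ^ 3 :=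
      mul_le_mul_of_nonneg_left h1 (by linarith)
    nlinarith [mul_pos hθ0 hθ0]
  obtain ⟨k₀, hk₀⟩ : ∃ k₀ : ℝ, k₀ = 4 / δ := ⟨_, rfl⟩
  have hk₀4 : 4 ≤ k₀ := by
    rw [hk₀, le_div_iff₀ hδ0]
    linarith
  obtain ⟨K, hK⟩ : ∃ K : ℝ, K = k₀ ^ 3 + 2 * (512 + C / δ ^ 3 + 256 * C) / θ := ⟨_, rfl⟩
  have hKa : k₀ ^ 3 ≤ K := by
    rw [hK]
    have : 0 ≤ 2 * (512 + C / δ ^ 3 + 256 * C) / θ := by positivity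
    linarith
  have hKb : 512 + C / δ ^ 3 + 256 * C ≤ K * (θ / 2) := by
    have h1 : 2 * (512 + C / δ ^ 3 + 256 * C) / θ ≤ K := by
      rw [hK]
      have : 0 ≤ k₀ ^ 3 := by positivity
      linarith
    rw [div_le_iff₀ hθ0] at h1
    linarith
  have hK0 : 0 < K := lt_of_lt_of_le (by positivity) hKa
  refine ⟨K, hK0, fun L => ?_⟩
  induction hcard : #L using Nat.strong_induction_on generalizing L with
  | _ n ih =>
  intro P k hk1 hP
  have hk0 : 0 < k := by linarith
  subst hcard
  by_cases hsmall : k ≤ k₀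
  · have h1 : (#P : ℝ) ≤ (#L : ℝ) ^ 2 := by
      exact_mod_cast card_le_sq_of_one_lt fun p hp => by exact_mod_cast hk1.trans_le (hP p hp)
    have h2 : (#L : ℝ) ^ 2 ≤ K * ((#L : ℝ) ^ 2 / k ^ 3) := by
      rw [← mul_div_assoc, le_div_iff₀ (by positivity), mul_comm]
      have : k ^ 3 ≤ K := (pow_le_pow_left₀ hk0.le hsmall 3).trans hKa
      gcongr
    linarith
  push Not at hsmall
  by_cases hlarge : 16 * (#L : ℝ) ≤ k ^ 2
  · have h1 := card_lt_of_sq_ge (by linarith) hlarge hP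
    have h2 : 0 ≤ K * ((#L : ℝ) ^ 2 / k ^ 3) := by positivity
    linarith
  push Not at hlarge
  have hn0 : (0 : ℝ) < #L := by nlinarith
  have hL1 : 1 ≤ #L := by exact_mod_cast hn0
  have hδk : 4 ≤ δ * k := by
    rw [hk₀, div_lt_iff₀ hδ0] at hsmall
    linarith
  obtain ⟨c', -, ρ, hρ0, hball, hmin⟩ := exists_min_ball L Prod.fst (t := ⌈θ * #L⌉₊)
    (Nat.one_le_ceil_iff.mpr (by positivity)) (Nat.ceil_le.mpr (by nlinarith))
  generalize c'.1 = c at hball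
  have hball' : θ * #L ≤ (#(L.filter fun l => dist l.1 c ≤ ρ) : ℝ) := Nat.ceil_le.mp hball
  have hL₂card : (#(L.filter fun l => ¬ dist l.1 c ≤ ρ) : ℝ) ≤ (1 - θ) * #L := by
    have h1 := card_filter_add_card_filter_not (s := L) (fun l => dist l.1 c ≤ ρ)
    have h2 : (#(L.filter fun l => dist l.1 c ≤ ρ) : ℝ) +
      #(L.filter fun l => ¬ dist l.1 c ≤ ρ) = #L := by exact_mod_cast h1
    linarith
  have hstep : ∀ (M R : Finset (ℂ × ℂ)) (η : ℝ), 0 ≤ η → η < 1 → (#M : ℝ) ≤ η * #L →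
      (∀ p ∈ R, (1 - δ) * k ≤ #(linesAt M p)) →
      (#R : ℝ) ≤ K * η ^ 2 / (1 - δ) ^ 3 * ((#L : ℝ) ^ 2 / k ^ 3) + k := by
    intro M R η hη0 hη1 hM hR
    have hlt : #M < #L := by
      have : (#M : ℝ) < #L := by nlinarith
      exact_mod_cast this
    have hδ' : 0 < 1 - δ := by linarith
    have h1 := ih _ hlt M rfl R ((1 - δ) * k) (by nlinarith) hR
    calc (#R : ℝ) ≤ K * ((#M : ℝ) ^ 2 / ((1 - δ) * k) ^ 3) + (1 - δ) * k := h1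
      _ ≤ K * ((η * #L) ^ 2 / ((1 - δ) * k) ^ 3) + k := by
        gcongr
        nlinarith
      _ = _ := by
        field_simp
  set L₂ := L.filter fun l => ¬ dist l.1 c ≤ ρ with hL₂
  set H := L.filter fun l => dist l.1 c ≤ ρ with hH
  set L₁ := L.filter fun l => dist l.1 c ≤ 16 * ρ with hL₁
  set V := L.filter fun l => ¬ dist l.1 c ≤ 16 * ρ with hV
  set X := (#L : ℝ) ^ 2 / k ^ 3 with hX
  have hX0 : 0 ≤ X := by positivity
  have hkX : k ≤ 256 * X := by
    rw [hX, ← mul_div_assoc, le_div_iff₀ (by positivity)]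
    have : (k ^ 2) ^ 2 ≤ (16 * (#L : ℝ)) ^ 2 := pow_le_pow_left₀ (by positivity) hlarge.le 2
    nlinarith
  set P₁ := P.filter fun p => (1 - δ) * k ≤ #(linesAt L₁ p) with hP₁
  set P₂ := P.filter fun p => (1 - δ) * k ≤ #(linesAt L₂ p) with hP₂
  set P₃ := P.filter fun p => δ * k ≤ #(linesAt H p) ∧ δ * k ≤ #(linesAt V p) with hP₃
  have h₂ : (#P₂ : ℝ) ≤ K * (1 - θ) ^ 2 / (1 - δ) ^ 3 * X + k :=
    hstep L₂ P₂ (1 - θ) (by linarith) (by linarith) hL₂card fun p hp => (mem_filter.mp hp).2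
  have hHL₂ : ∀ p, (#(linesAt H p) : ℝ) + #(linesAt L₂ p) = #(linesAt L p) := fun p => by
    exact_mod_cast card_linesAt_split L p (fun l => dist l.1 c ≤ ρ)
  have hL₁V : ∀ p, (#(linesAt L₁ p) : ℝ) + #(linesAt V p) = #(linesAt L p) := fun p => by
    exact_mod_cast card_linesAt_split L p (fun l => dist l.1 c ≤ 16 * ρ)
  have hmain : (#P : ℝ) ≤ (K * (N * θ) ^ 2 / (1 - δ) ^ 3 * X + k) +
      (K * (1 - θ) ^ 2 / (1 - δ) ^ 3 * X + k) + C * (X / δ ^ 3 + k) := by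
    rcases hρ0.lt_or_eq with hρ | hρ
    · have h₁ : (#P₁ : ℝ) ≤ K * (N * θ) ^ 2 / (1 - δ) ^ 3 * X + k := by
        refine hstep L₁ P₁ (N * θ) (by positivity) hNθ ?_ fun p hp => (mem_filter.mp hp).2
        rw [mul_assoc]
        exact hcover L Prod.fst ρ (θ * #L) c hρ (by positivity)
          fun p hp => (Nat.lt_ceil.mp (hmin p hp)).le
      have h₃ : (#P₃ : ℝ) ≤ C * (X / δ ^ 3 + k) := by
        have h := hsep H V P₃ (δ * k) c ρ hρ (fun l hl => (mem_filter.mp hl).2)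
          (fun l hl => (not_le.mp (mem_filter.mp hl).2).le) (by linarith)
          (fun p hp => (mem_filter.mp hp).2.1) (fun p hp => (mem_filter.mp hp).2.2)
        have hHV : (#H : ℝ) * #V ≤ (#L : ℝ) ^ 2 := by
          rw [sq]
          gcongr <;> exact filter_subset _ _
        calc (#P₃ : ℝ) ≤ C * (#H * #V / (δ * k) ^ 3 + δ * k) := h
          _ ≤ C * ((#L : ℝ) ^ 2 / (δ * k) ^ 3 + k) := by
            gcongr
            nlinarith
          _ = C * (X / δ ^ 3 + k) := by
            rw [hX]
            field_simp
      have hsub : P ⊆ P₁ ∪ P₂ ∪ P₃ := by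
        intro p hp
        have a1 := hHL₂ p
        have a2 := hL₁V p
        have a3 := hP p hp
        simp only [mem_union, hP₁, hP₂, hP₃, mem_filter, hp, true_and]
        by_contra! hcon
        obtain ⟨⟨c1, c2⟩, c3⟩ := hcon
        have c4 : δ * k ≤ #(linesAt H p) := by linarith
        have c5 := c3 c4
        linarith
      have : (#P : ℝ) ≤ #P₁ + #P₂ + #P₃ := by
        exact_mod_cast (card_le_card hsub).trans
          ((card_union_le _ _).trans (Nat.add_le_add_right (card_union_le _ _) _))
      linarith
    · have hsub : P ⊆ P₂ := by
        intro p hp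
        refine mem_filter.mpr ⟨hp, ?_⟩
        have a1 := hHL₂ p
        have a3 := hP p hp
        have a4 : (#(linesAt H p) : ℝ) ≤ 1 := by
          exact_mod_cast card_linesAt_le_one_of_parallel (c := c) (fun l hl => by
            have := (mem_filter.mp hl).2
            rw [← hρ] at this
            exact dist_le_zero.mp this) p
        linarith
      have h1 : (#P : ℝ) ≤ #P₂ := by exact_mod_cast card_le_card hsub
      have h2 : 0 ≤ K * (N * θ) ^ 2 / (1 - δ) ^ 3 * X :=
        mul_nonneg (div_nonneg (by positivity) (pow_nonneg (by linarith) 3)) hX0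
      have h3 : 0 ≤ C * (X / δ ^ 3 + k) := by positivity
      linarith
  have hab : (N * θ) ^ 2 + (1 - θ) ^ 2 ≤ 1 - θ := by
    linear_combination θ * hθN.le
  have hfinal := contraction_arith hK0.le hX0 (show 0 < (1 - δ) ^ 3 from pow_pos (by linarith) 3)
    hab hδ3 hKb hkX hC.le
  have hexpand : C * (X / δ ^ 3 + k) = C / δ ^ 3 * X + C * k := by ring
  linarith [mul_nonneg hK0.le hX0]

lemma sum_card_linesAt_le_of_sq_ge {L P : Finset (ℂ × ℂ)}
    (h : ∀ p ∈ P, 16 * #L ≤ #(linesAt L p) ^ 2) : ∑ p ∈ P, #(linesAt L p) ≤ 2 * #L := by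
  rcases Nat.eq_zero_or_pos #L with h0 | h0
  · rw [card_eq_zero] at h0
    simp [h0, linesAt]
  have hn : (1 : ℝ) ≤ #L := by exact_mod_cast h0
  have hs : (√(#L : ℝ)) ^ 2 = #L := Real.sq_sqrt (by positivity)
  have hs1 : 1 ≤ √(#L : ℝ) := Real.one_le_sqrt.mpr hn
  have h1 := card_lt_of_sq_ge (L := L) (P := P) (k := 4 * √(#L : ℝ)) (by linarith)
    (by rw [mul_pow, hs]; norm_num) fun p hp => by
      refine le_of_sq_le_sq ?_ (Nat.cast_nonneg _)
      rw [mul_pow, hs]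
      norm_num
      exact_mod_cast h p hp
  have h2 : #P ^ 2 ≤ #L := by
    have : (#P : ℝ) ^ 2 ≤ #L := by
      rw [← hs]
      exact pow_le_pow_left₀ (by positivity) (by linarith) 2
    exact_mod_cast this
  have h3 := sum_card_linesAt_le L P
  have h4 := card_le_card (linesMeeting_subset L P)
  omega

lemma sum_Ioc_inv_cube_le {k n : ℕ} (hk : k ≠ 0) :
    ∑ j ∈ Ioc k n, 1 / (j : ℝ) ^ 3 ≤ 1 / (k : ℝ) ^ 2 := by
  have hk0 : (0 : ℝ) < k := by positivity
  rcases le_total k n with h | h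
  · calc ∑ j ∈ Ioc k n, 1 / (j : ℝ) ^ 3 ≤ ∑ j ∈ Ioc k n, (k : ℝ)⁻¹ * ((j : ℝ) ^ 2)⁻¹ := by
          refine sum_le_sum fun j hj => ?_
          have hkj : (k : ℝ) ≤ j := by exact_mod_cast (mem_Ioc.mp hj).1.le
          have hj0 : (0 : ℝ) < j := hk0.trans_le hkj
          rw [← mul_inv, one_div]
          refine inv_anti₀ (by positivity) ?_
          nlinarith [pow_pos hj0 2]
      _ ≤ (k : ℝ)⁻¹ * (k : ℝ)⁻¹ := by
          rw [← mul_sum]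
          have := sum_Ioc_inv_sq_le_sub (α := ℝ) hk h
          have : (0 : ℝ) ≤ (n : ℝ)⁻¹ := by positivity
          gcongr
          linarith
      _ = 1 / (k : ℝ) ^ 2 := by field_simp
  · rw [Ioc_eq_empty_of_le h]
    simp

lemma exists_sum_card_linesAt_le_of_sq_lt :
    ∃ A : ℝ, 0 < A ∧ ∀ (L P : Finset (ℂ × ℂ)) (k : ℕ), k ≠ 0 →
      (∀ p ∈ P, #(linesAt L p) ^ 2 < 16 * #L) →
      ∑ p ∈ P, (#(linesAt L p) : ℝ) ≤ #P * k + A * ((#L : ℝ) ^ 2 / k ^ 2) := by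
  obtain ⟨K, hK, hrich⟩ := exists_card_rich_le
  refine ⟨K + 256, by positivity, fun L P k hk hP => ?_⟩
  have hpoint : ∀ p, #(linesAt L p) ≤ k + #{j ∈ Ioc k #L | j ≤ #(linesAt L p)} := by
    intro p
    have h1 : #(linesAt L p) ≤ #L := card_le_card (filter_subset _ _)
    have h2 : Ioc k #(linesAt L p) ⊆ {j ∈ Ioc k #L | j ≤ #(linesAt L p)} := by
      intro j hj
      rw [mem_Ioc] at hj
      simp only [mem_filter, mem_Ioc]
      omega
    have h3 := card_le_card h2
    rw [Nat.card_Ioc] at h3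
    omega
  have hlevel : ∀ j ∈ Ioc k #L, (#{p ∈ P | j ≤ #(linesAt L p)} : ℝ) ≤
      (K + 256) * (#L : ℝ) ^ 2 * (1 / (j : ℝ) ^ 3) := by
    intro j hj
    have hj1 : 1 < j := (Nat.one_le_iff_ne_zero.mpr hk).trans_lt (mem_Ioc.mp hj).1
    have hj1' : (1 : ℝ) < j := by exact_mod_cast hj1
    rcases eq_empty_or_nonempty {p ∈ P | j ≤ #(linesAt L p)} with h0 | ⟨p, hp⟩
    · rw [h0, card_empty, Nat.cast_zero]
      positivity
    rw [mem_filter] at hp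
    have h1 : j ^ 2 ≤ 16 * #L := (Nat.pow_le_pow_left hp.2 2).trans (hP p hp.1).le
    have h2 : ((j : ℝ) ^ 2) ^ 2 ≤ (16 * (#L : ℝ)) ^ 2 :=
      pow_le_pow_left₀ (by positivity) (by exact_mod_cast h1) 2
    have h3 : (j : ℝ) ≤ 256 * (#L : ℝ) ^ 2 / (j : ℝ) ^ 3 := by
      rw [le_div_iff₀ (by positivity)]
      linarith
    have h4 := hrich L {p ∈ P | j ≤ #(linesAt L p)} j hj1' fun q hq => by
      exact_mod_cast (mem_filter.mp hq).2
    calc _ ≤ K * ((#L : ℝ) ^ 2 / (j : ℝ) ^ 3) + j := h4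
      _ ≤ K * ((#L : ℝ) ^ 2 / (j : ℝ) ^ 3) + 256 * (#L : ℝ) ^ 2 / (j : ℝ) ^ 3 := by linarith
      _ = _ := by ring
  have hswap : ∑ p ∈ P, #{j ∈ Ioc k #L | j ≤ #(linesAt L p)} =
      ∑ j ∈ Ioc k #L, #{p ∈ P | j ≤ #(linesAt L p)} :=
    sum_card_bipartiteAbove_eq_sum_card_bipartiteBelow fun p j => j ≤ #(linesAt L p)
  calc ∑ p ∈ P, (#(linesAt L p) : ℝ)
      ≤ ∑ p ∈ P, ((k : ℝ) + #{j ∈ Ioc k #L | j ≤ #(linesAt L p)}) :=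
        sum_le_sum fun p _ => by exact_mod_cast hpoint p
    _ = #P * k + ∑ j ∈ Ioc k #L, (#{p ∈ P | j ≤ #(linesAt L p)} : ℝ) := by
        rw [sum_add_distrib, sum_const, nsmul_eq_mul]
        congr 1
        exact_mod_cast hswap
    _ ≤ #P * k + ∑ j ∈ Ioc k #L, (K + 256) * (#L : ℝ) ^ 2 * (1 / (j : ℝ) ^ 3) := by
        gcongr with j hj
        exact hlevel j hj
    _ ≤ #P * k + (K + 256) * (#L : ℝ) ^ 2 * (1 / (k : ℝ) ^ 2) := by
        rw [← mul_sum]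
        gcongr
        exact sum_Ioc_inv_cube_le hk
    _ = _ := by ring

lemma exists_pos_cube_eq {x : ℝ} (hx : 0 < x) :
    ∃ a : ℝ, 0 < a ∧ x = a ^ 3 ∧ x ^ ((2 : ℝ) / 3) = a ^ 2 := by
  refine ⟨x ^ ((1 : ℝ) / 3), Real.rpow_pos_of_pos hx _, ?_, ?_⟩ <;>
  · rw [← Real.rpow_natCast, ← Real.rpow_mul hx.le]
    norm_num

/-- Szemerédi–Trotter for non-vertical complex lines. -/
lemma exists_sum_card_linesAt_le :
    ∃ A : ℝ, 0 < A ∧ ∀ L P : Finset (ℂ × ℂ), ∑ p ∈ P, (#(linesAt L p) : ℝ) ≤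
      A * ((#P : ℝ) ^ ((2 : ℝ) / 3) * (#L : ℝ) ^ ((2 : ℝ) / 3)) + #P + 2 * #L := by
  obtain ⟨A, hA, hsmall⟩ := exists_sum_card_linesAt_le_of_sq_lt
  refine ⟨1 + A, by positivity, fun L P => ?_⟩
  rcases Nat.eq_zero_or_pos #P with hP | hP
  · rw [card_eq_zero] at hP
    rw [hP, sum_empty]
    positivity
  rcases Nat.eq_zero_or_pos #L with hL | hL
  · rw [card_eq_zero] at hL
    simp only [hL, linesAt, filter_empty, card_empty, Nat.cast_zero, sum_const_zero]
    positivity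
  have hsplit := sum_filter_add_sum_filter_not P (fun p => #(linesAt L p) ^ 2 < 16 * #L)
    fun p => (#(linesAt L p) : ℝ)
  have hbig : ∑ p ∈ P with ¬ #(linesAt L p) ^ 2 < 16 * #L, (#(linesAt L p) : ℝ) ≤ 2 * #L := by
    exact_mod_cast sum_card_linesAt_le_of_sq_ge fun p hp => not_lt.mp (mem_filter.mp hp).2
  obtain ⟨a, ha0, ha3, ha2⟩ := exists_pos_cube_eq (x := #P) (by exact_mod_cast hP)
  obtain ⟨b, hb0, hb3, hb2⟩ := exists_pos_cube_eq (x := #L) (by exact_mod_cast hL)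
  have hk0 : 0 < b ^ 2 / a := by positivity
  have h1 := hsmall L {p ∈ P | #(linesAt L p) ^ 2 < 16 * #L} ⌈b ^ 2 / a⌉₊
    (Nat.ceil_pos.mpr hk0).ne' fun p hp => (mem_filter.mp hp).2
  have h2 : (#{p ∈ P | #(linesAt L p) ^ 2 < 16 * #L} : ℝ) * (⌈b ^ 2 / a⌉₊ : ℝ) ≤
      a ^ 2 * b ^ 2 + a ^ 3 := by
    calc _ ≤ (#P : ℝ) * (b ^ 2 / a + 1) := by
          gcongr
          · exact filter_subset _ _
          · exact (Nat.ceil_lt_add_one hk0.le).le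
      _ = _ := by
          rw [ha3]
          field_simp
  have h3 : (#L : ℝ) ^ 2 / (⌈b ^ 2 / a⌉₊ : ℝ) ^ 2 ≤ a ^ 2 * b ^ 2 := by
    calc _ ≤ (#L : ℝ) ^ 2 / (b ^ 2 / a) ^ 2 := by
          gcongr
          exact Nat.le_ceil _
      _ = _ := by
          rw [hb3]
          field_simp
  have h4 := mul_le_mul_of_nonneg_left h3 hA.le
  rw [ha2, hb2, ← hsplit]
  linarith

/-- The complex line of slope `l.1` and intercept `l.2`. -/
def lineSet (l : ℂ × ℂ) : Set (ℂ × ℂ) := {z | OnLine z l}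

lemma setOf_eq_lineSet {a b c : ℂ} (hb : b ≠ 0) :
    {z : ℂ × ℂ | a * z.1 + b * z.2 = c} = lineSet (-a / b, c / b) := by
  ext z
  simp only [lineSet, OnLine, Set.mem_ofPred_eq]
  field_simp
  constructor <;> intro h <;> linear_combination h

lemma card_filter_vertical_le_one {M : Finset (Set (ℂ × ℂ))}
    (hM : ∀ l ∈ M, ∃ x : ℂ, l = {z | z.1 = x}) (p : ℂ × ℂ) : #{l ∈ M | p ∈ l} ≤ 1 := by
  rw [card_le_one]
  intro l hl l' hl'
  rw [mem_filter] at hl hl'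
  obtain ⟨x, rfl⟩ := hM l hl.1
  obtain ⟨y, rfl⟩ := hM l' hl'.1
  rw [← show p.1 = x from hl.2, ← show p.1 = y from hl'.2]

/-- Every finite family of complex lines is made of non-vertical ones, given by slope and
intercept, and of vertical ones, at most one through each point. -/
lemma exists_card_filter_mem_le {M : Finset (Set (ℂ × ℂ))}
    (hM : ∀ l ∈ M, ∃ a b c : ℂ, (a, b) ≠ (0, 0) ∧ l = {z : ℂ × ℂ | a * z.1 + b * z.2 = c}) :
    ∃ L : Finset (ℂ × ℂ), #L ≤ #M ∧ ∀ p, #{l ∈ M | p ∈ l} ≤ #(linesAt L p) + 1 := by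
  have hcase : ∀ l ∈ M, (∃ x : ℂ, l = {z | z.1 = x}) ∨ ∃ s, l = lineSet s := by
    intro l hl
    obtain ⟨a, b, c, hab, rfl⟩ := hM l hl
    by_cases hb : b = 0
    · subst hb
      have ha : a ≠ 0 := fun ha => hab (by rw [ha])
      refine Or.inl ⟨c / a, ?_⟩
      ext z
      simp only [Set.mem_ofPred_eq, zero_mul, add_zero]
      rw [eq_div_iff ha, mul_comm]
    · exact Or.inr ⟨_, setOf_eq_lineSet hb⟩
  have hex : ∀ l ∈ M.filter fun l => ¬ ∃ x : ℂ, l = {z | z.1 = x}, ∃ s, l = lineSet s :=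
    fun l hl => (hcase l (mem_filter.mp hl).1).resolve_left (mem_filter.mp hl).2
  choose! f hf using hex
  refine ⟨(M.filter fun l => ¬ ∃ x : ℂ, l = {z | z.1 = x}).image f,
    card_image_le.trans (card_le_card (filter_subset _ _)), fun p => ?_⟩
  have h1 := card_filter_add_card_filter_not (s := {l ∈ M | p ∈ l})
    fun l => ¬ ∃ x : ℂ, l = {z | z.1 = x}
  have h2 : #{l ∈ {l ∈ M | p ∈ l} | ¬ ∃ x : ℂ, l = {z | z.1 = x}} ≤
      #(linesAt ((M.filter fun l => ¬ ∃ x : ℂ, l = {z | z.1 = x}).image f) p) := by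
    refine card_le_card_of_injOn f (fun l hl => ?_) fun l hl l' hl' h => ?_
    · rw [coe_filter, Set.mem_ofPred_eq, mem_filter] at hl
      have hl' : l ∈ M.filter fun l => ¬ ∃ x : ℂ, l = {z | z.1 = x} :=
        mem_filter.mpr ⟨hl.1.1, hl.2⟩
      refine mem_filter.mpr ⟨mem_image_of_mem f hl', ?_⟩
      have := hl.1.2
      rw [hf l hl'] at this
      exact this
    · rw [coe_filter, Set.mem_ofPred_eq, mem_filter] at hl hl'
      rw [hf l (mem_filter.mpr ⟨hl.1.1, hl.2⟩), hf l' (mem_filter.mpr ⟨hl'.1.1, hl'.2⟩), h]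
  have h3 : #{l ∈ {l ∈ M | p ∈ l} | ¬ ¬ ∃ x : ℂ, l = {z | z.1 = x}} ≤ 1 := by
    refine (card_le_card ?_).trans (card_filter_vertical_le_one
      (M := M.filter fun l => ∃ x : ℂ, l = {z | z.1 = x}) (fun l hl => (mem_filter.mp hl).2) p)
    intro l hl
    simp only [mem_filter, not_not] at hl ⊢
    exact ⟨⟨hl.1.1, hl.2⟩, hl.1.2⟩
  omega

lemma ncard_incidences (P : Finset (ℂ × ℂ)) (M : Finset (Set (ℂ × ℂ))) :
    Set.ncard {pl : (ℂ × ℂ) × Set (ℂ × ℂ) | pl.1 ∈ P ∧ pl.2 ∈ M ∧ pl.1 ∈ pl.2} =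
      ∑ p ∈ P, #{l ∈ M | p ∈ l} := by
  rw [← card_sigma, ← Set.ncard_coe_finset]
  refine Set.ncard_congr (fun x _ => ⟨x.1, x.2⟩) ?_ ?_ ?_
  · rintro x ⟨h1, h2, h3⟩
    simpa using ⟨h1, h2, h3⟩
  · rintro x y - - h
    simp only [Sigma.mk.injEq, heq_eq_eq] at h
    exact Prod.ext h.1 h.2
  · rintro ⟨p, l⟩ h
    exact ⟨(p, l), by simpa using h, rfl⟩

end ComplexSzemerediTrotter

/-- The complex Szemerédi–Trotter theorem (Tóth): `m` points and `n` complex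
lines in `ℂ²` determine at most `O(m^(2/3) n^(2/3) + m + n)` incidences. -/
theorem stmt_19 :
    ∃ C : ℝ, 0 < C ∧ ∀ (m n : ℕ) (P : Finset (ℂ × ℂ)) (L : Finset (Set (ℂ × ℂ))),
      P.card = m → L.card = n →
      (∀ l ∈ L, ∃ a b c : ℂ, (a, b) ≠ (0, 0) ∧ l = {z : ℂ × ℂ | a * z.1 + b * z.2 = c}) →
      (Set.ncard {pl : (ℂ × ℂ) × Set (ℂ × ℂ) | pl.1 ∈ P ∧ pl.2 ∈ L ∧ pl.1 ∈ pl.2} : ℝ) ≤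
        C * ((m : ℝ) ^ ((2:ℝ)/3) * (n : ℝ) ^ ((2:ℝ)/3) + (m : ℝ) + (n : ℝ)) := by
  classical
  open ComplexSzemerediTrotter Finset in
  obtain ⟨A, hA, hbound⟩ := exists_sum_card_linesAt_le
  refine ⟨A + 2, by positivity, ?_⟩
  rintro m n P L rfl rfl hL
  obtain ⟨L', hcard, hle⟩ := exists_card_filter_mem_le hL
  have h1 : ∑ p ∈ P, (#{l ∈ L | p ∈ l} : ℝ) ≤ ∑ p ∈ P, ((#(linesAt L' p) : ℝ) + 1) :=
    sum_le_sum fun p _ => by exact_mod_cast hle p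
  rw [sum_add_distrib, sum_const, nsmul_eq_mul, mul_one] at h1
  have hcard' : (#L' : ℝ) ≤ #L := by exact_mod_cast hcard
  have h2 : (#P : ℝ) ^ ((2 : ℝ) / 3) * (#L' : ℝ) ^ ((2 : ℝ) / 3) ≤
      (#P : ℝ) ^ ((2 : ℝ) / 3) * (#L : ℝ) ^ ((2 : ℝ) / 3) := by gcongr
  have h3 := mul_le_mul_of_nonneg_left h2 hA.le
  have h4 : 0 ≤ (#P : ℝ) ^ ((2 : ℝ) / 3) * (#L : ℝ) ^ ((2 : ℝ) / 3) := by positivity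
  have h5 := hbound L' P
  have h6 : 0 ≤ A * #P := by positivity
  have h7 : 0 ≤ A * #L := by positivity
  rw [ncard_incidences, Nat.cast_sum]
  linarith
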